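/- A bipartition (λ | μ) of n is the cycle type of the square of some element of B_n if and only if every even part of λ has even multiplicity and every part of μ has even multiplicity. -/

import Mathlib

/-- Negation on `{±1,…,±n}`, modelled as `Fin n × ZMod 2` with `(i,s) ↦ (i,s+1)`. -/
def negPerm (n : ℕ) : Equiv.Perm (Fin n × ZMod 2) :=
  Equiv.prodCongr (Equiv.refl (Fin n)) (Equiv.addLeft (1 : ZMod 2))

/-- The hyperoctahedral group `B_n` of signed permutations. -/
def hyperoctahedral (n : ℕ) : Subgroup (Equiv.Perm (Fin n × ZMod 2)) :=
  Subgroup.centralizer {negPerm n}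

/-- `w ∈ B_n` has cycle type the bipartition `(lam | mu)`: `mu` is the multiset
of (half-)lengths of the negative cycles of `w` (the cycles of `w` on the `2n`
points whose support is negation-invariant), and `lam` is the multiset of
lengths of the positive cycles; each positive cycle of `w` of length `≥ 2`
appears as two cycles on the `2n` points, and each positive fixed point `i`
appears as the two fixed points `±i`. -/
def IsBnCycleType (n : ℕ) (w : Equiv.Perm (Fin n × ZMod 2))
    (lam mu : Multiset ℕ) : Prop :=
  lam + lam =
      Multiset.replicate
        (2 * (Finset.univ.filter
          (fun i : Fin n => w (i, (0 : ZMod 2)) = (i, (0 : ZMod 2)))).card) 1 +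
      (w.cycleFactorsFinset.filter
        (fun c => ¬ c.support.image (negPerm n) = c.support)).val.map
        (fun c => c.support.card) ∧
  mu = (w.cycleFactorsFinset.filter
        (fun c => c.support.image (negPerm n) = c.support)).val.map
        (fun c => c.support.card / 2)

open Equiv Equiv.Perm Function in
theorem Equiv.Perm.pow_apply_eq_self_iff_minimalPeriod_dvd {α : Type*} (f : Perm α) (x : α)
    (m : ℕ) : (f ^ m) x = x ↔ minimalPeriod f x ∣ m := by
  rw [← isPeriodicPt_iff_minimalPeriod_dvd, IsPeriodicPt, IsFixedPt, ← coe_pow]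

namespace BnSquare

open Equiv Equiv.Perm Finset
open Function (minimalPeriod)

theorem card_support_cycleOf {α : Type*} [Fintype α] [DecidableEq α] (f : Perm α) {x : α}
    (hx : f x ≠ x) : #(f.cycleOf x).support = minimalPeriod f x := by
  have hc := isCycle_cycleOf f hx
  have hx' : f.cycleOf x x ≠ x := by rwa [cycleOf_apply_self]
  have key (m : ℕ) : minimalPeriod f x ∣ m ↔ orderOf (f.cycleOf x) ∣ m := by
    rw [← pow_apply_eq_self_iff_minimalPeriod_dvd, orderOf_dvd_iff_pow_eq_one,
      hc.pow_eq_one_iff' hx', cycleOf_pow_apply_self]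
  rw [← hc.orderOf]
  exact Nat.dvd_antisymm ((key _).1 dvd_rfl) ((key _).2 dvd_rfl)

/-- Counting points by the cycle they lie on. -/
theorem card_points_eq_mul_card_cycles {α : Type*} [Fintype α] [DecidableEq α] (f : Perm α)
    (k : ℕ) (P : α → Prop) [DecidablePred P] (Q : Perm α → Prop) [DecidablePred Q]
    (hPQ : ∀ x, f x ≠ x → (P x ↔ Q (f.cycleOf x))) (hk : 2 ≤ k) :
    #{x | minimalPeriod f x = k ∧ P x} = k * #{c ∈ f.cycleFactorsFinset | #c.support = k ∧ Q c} := by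
  have hmove {x : α} (hx : minimalPeriod f x = k) : f x ≠ x := fun h => by
    have := Function.minimalPeriod_eq_one_iff_isFixedPt.2 h
    omega
  rw [card_eq_sum_card_fiberwise (f := f.cycleOf)
    (t := {c ∈ f.cycleFactorsFinset | #c.support = k ∧ Q c})]
  · rw [sum_const_nat (m := k), mul_comm]
    intro c hc
    obtain ⟨hcf, hck, hcQ⟩ := by simpa using hc
    rw [← hck]
    congr 1
    ext x
    simp only [mem_filter, mem_univ, true_and]
    constructor
    · rintro ⟨⟨hx, -⟩, rfl⟩
      exact mem_support_cycleOf_iff.2 ⟨.refl _ _, mem_support.2 (hmove (hx.trans hck))⟩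
    · intro hx
      obtain rfl := cycle_is_cycleOf hx hcf
      have hfx := mem_support.1 (mem_support_cycleOf_iff.1 hx).2
      exact ⟨⟨(card_support_cycleOf f hfx).symm, (hPQ x hfx).2 hcQ⟩, rfl⟩
  · intro x hx
    obtain ⟨hxk, hxP⟩ : minimalPeriod f x = k ∧ P x := by simpa using hx
    have hfx := hmove hxk
    simp only [coe_filter, Set.mem_ofPred_eq, cycleOf_mem_cycleFactorsFinset_iff, mem_support]
    exact ⟨hfx, (card_support_cycleOf f hfx).trans hxk, (hPQ x hfx).1 hxP⟩

section hyperoctahedral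

variable {n : ℕ}

theorem negPerm_apply (x : Fin n × ZMod 2) : negPerm n x = (x.1, 1 + x.2) := rfl

theorem negPerm_ne (x : Fin n × ZMod 2) : negPerm n x ≠ x := fun h => by
  simpa [negPerm_apply] using congrArg Prod.snd h

theorem negPerm_negPerm (x : Fin n × ZMod 2) : negPerm n (negPerm n x) = x := by
  ext
  · rfl
  · simp only [negPerm_apply, ← add_assoc, CharTwo.add_self_eq_zero, zero_add]

theorem mem_hyperoctahedral_iff {w : Perm (Fin n × ZMod 2)} :
    w ∈ hyperoctahedral n ↔ Commute w (negPerm n) := by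
  rw [hyperoctahedral, Subgroup.mem_centralizer_singleton_iff, commute_iff_eq]

variable {w : Perm (Fin n × ZMod 2)}

theorem pow_negPerm (hw : Commute w (negPerm n)) (m : ℕ) (x : Fin n × ZMod 2) :
    (w ^ m) (negPerm n x) = negPerm n ((w ^ m) x) :=
  DFunLike.congr_fun (hw.pow_left m).eq x

theorem sameCycle_negPerm (hw : Commute w (negPerm n)) {x y : Fin n × ZMod 2}
    (h : w.SameCycle x y) : w.SameCycle (negPerm n x) (negPerm n y) := by
  obtain ⟨m, rfl⟩ := h.exists_nat_pow_eq
  exact ⟨m, by rw [zpow_natCast, pow_negPerm hw]⟩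

theorem exists_pow_of_sameCycle_negPerm (hw : Commute w (negPerm n)) {x : Fin n × ZMod 2}
    (h : w.SameCycle x (negPerm n x)) :
    ∃ m : ℕ, (w ^ m) x = negPerm n x ∧ minimalPeriod w x ∣ 2 * m ∧ ¬ minimalPeriod w x ∣ m := by
  obtain ⟨m, hm⟩ := h.exists_nat_pow_eq
  refine ⟨m, hm, ?_, ?_⟩
  · rw [← pow_apply_eq_self_iff_minimalPeriod_dvd, two_mul, pow_add, mul_apply, hm,
      pow_negPerm hw, hm, negPerm_negPerm]
  · rw [← pow_apply_eq_self_iff_minimalPeriod_dvd, hm]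
    exact negPerm_ne x

theorem even_minimalPeriod_of_sameCycle (hw : Commute w (negPerm n)) {x : Fin n × ZMod 2}
    (h : w.SameCycle x (negPerm n x)) : Even (minimalPeriod w x) := by
  obtain ⟨m, -, h1, h2⟩ := exists_pow_of_sameCycle_negPerm hw h
  by_contra ho
  exact h2 ((Nat.Coprime.dvd_mul_left (Nat.not_even_iff_odd.1 ho).coprime_two_right).1 h1)

theorem sameCycle_negPerm_iff_image_support (hw : Commute w (negPerm n)) {x : Fin n × ZMod 2}
    (hx : w x ≠ x) : w.SameCycle x (negPerm n x) ↔
      (w.cycleOf x).support.image (negPerm n) = (w.cycleOf x).support := by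
  constructor
  · intro h
    refine eq_of_subset_of_card_le ?_ (card_image_of_injective _ (negPerm n).injective).ge
    intro y hy
    obtain ⟨z, hz, rfl⟩ := mem_image.1 hy
    rw [mem_support_cycleOf_iff' hx] at hz ⊢
    exact h.trans (sameCycle_negPerm hw hz)
  · intro h
    rw [← mem_support_cycleOf_iff' hx, ← h]
    exact mem_image_of_mem _ ((mem_support_cycleOf_iff' hx).2 (.refl _ _))

/-- The points on the positive cycles of length `k` of a signed permutation. -/
noncomputable def posPoints (w : Perm (Fin n × ZMod 2)) (k : ℕ) : Finset (Fin n × ZMod 2) :=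
  {x | minimalPeriod w x = k ∧ ¬ w.SameCycle x (negPerm n x)}

/-- The points on the negative cycles of (half-)length `k` of a signed permutation. -/
noncomputable def negPoints (w : Perm (Fin n × ZMod 2)) (k : ℕ) : Finset (Fin n × ZMod 2) :=
  {x | minimalPeriod w x = 2 * k ∧ w.SameCycle x (negPerm n x)}

theorem mem_posPoints {k : ℕ} {x : Fin n × ZMod 2} :
    x ∈ posPoints w k ↔ minimalPeriod w x = k ∧ ¬ w.SameCycle x (negPerm n x) := by
  simp [posPoints]

theorem mem_negPoints {k : ℕ} {x : Fin n × ZMod 2} :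
    x ∈ negPoints w k ↔ minimalPeriod w x = 2 * k ∧ w.SameCycle x (negPerm n x) := by
  simp [negPoints]

theorem card_posPoints (hw : Commute w (negPerm n)) {k : ℕ} (hk : 2 ≤ k) :
    #(posPoints w k) = k * #{c ∈ w.cycleFactorsFinset | #c.support = k ∧
      ¬ c.support.image (negPerm n) = c.support} :=
  card_points_eq_mul_card_cycles w k _ _
    (fun _ hx => not_congr (sameCycle_negPerm_iff_image_support hw hx)) hk

theorem card_negPoints (hw : Commute w (negPerm n)) {k : ℕ} (hk : 0 < k) :
    #(negPoints w k) = 2 * k * #{c ∈ w.cycleFactorsFinset | #c.support = 2 * k ∧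
      c.support.image (negPerm n) = c.support} :=
  card_points_eq_mul_card_cycles w (2 * k) _ _
    (fun _ hx => sameCycle_negPerm_iff_image_support hw hx) (by omega)

theorem card_posPoints_one (hw : Commute w (negPerm n)) :
    #(posPoints w 1) = 2 * #{i : Fin n | w (i, (0 : ZMod 2)) = (i, (0 : ZMod 2))} := by
  have hneg (i : Fin n) : negPerm n (i, 0) = (i, 1) := rfl
  have h01 (i : Fin n) : w (i, 1) = (i, 1) ↔ w (i, 0) = (i, 0) := by
    rw [← hneg, show w (negPerm n (i, 0)) = negPerm n (w (i, 0)) from pow_negPerm hw 1 _,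
      (negPerm n).injective.eq_iff]
  have : posPoints w 1 =
      ({i : Fin n | w (i, (0 : ZMod 2)) = (i, (0 : ZMod 2))} : Finset _) ×ˢ univ := by
    ext ⟨i, s⟩
    rw [mem_posPoints, mem_product, mem_filter, Function.minimalPeriod_eq_one_iff_isFixedPt]
    have hs : Function.IsFixedPt w (i, s) ↔ w (i, 0) = (i, 0) := by
      fin_cases s
      · rfl
      · exact h01 i
    simp only [hs, mem_univ, true_and, and_true, and_iff_left_iff_imp]
    intro hi h
    exact negPerm_ne _ (h.eq_of_left (hs.2 hi)).symm
  rw [this, card_product, mul_comm]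
  rfl

theorem even_card_support (hw : Commute w (negPerm n)) {c : Perm (Fin n × ZMod 2)}
    (hc : c ∈ w.cycleFactorsFinset) (h : c.support.image (negPerm n) = c.support) :
    Even (#c.support) := by
  obtain ⟨x, hx⟩ := (mem_cycleFactorsFinset_iff.1 hc).1.nonempty_support
  obtain rfl := cycle_is_cycleOf hx hc
  have hfx := mem_support.1 (mem_support_cycleOf_iff.1 hx).2
  rw [card_support_cycleOf w hfx]
  exact even_minimalPeriod_of_sameCycle hw ((sameCycle_negPerm_iff_image_support hw hfx).2 h)

/-- The positive cycles of given length come in pairs `c`, `-c`. -/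
theorem even_card_positive_cycles (hw : Commute w (negPerm n)) (k : ℕ) :
    Even #{c ∈ w.cycleFactorsFinset | #c.support = k ∧
      ¬ c.support.image (negPerm n) = c.support} := by
  have hsupp (c : Perm (Fin n × ZMod 2)) :
      (negPerm n * c * (negPerm n)⁻¹).support = c.support.image (negPerm n) := by
    rw [support_conj, map_eq_image]; rfl
  have himage (s : Finset (Fin n × ZMod 2)) : (s.image (negPerm n)).image (negPerm n) = s := by
    rw [image_image, show negPerm n ∘ negPerm n = id from funext negPerm_negPerm, image_id]
  have hinv : (negPerm n)⁻¹ = negPerm n :=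
    inv_eq_of_mul_eq_one_right (Equiv.ext negPerm_negPerm)
  rw [← ZMod.natCast_eq_zero_iff_even, card_eq_sum_ones, Nat.cast_sum]
  refine sum_involution (fun c _ => negPerm n * c * (negPerm n)⁻¹) ?_ ?_ ?_ ?_
  · intros; decide
  · intro c hc _ h
    refine (mem_filter.1 hc).2.2 ?_
    rw [← hsupp, h]
  · intro c hc
    obtain ⟨hcf, hck, hcQ⟩ := mem_filter.1 hc
    refine mem_filter.2 ⟨?_, ?_, ?_⟩
    · have := (mem_cycleFactorsFinset_conj w (negPerm n) c).2 hcf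
      rwa [← hw.eq, mul_inv_cancel_right] at this
    · rw [hsupp, card_image_of_injective _ (negPerm n).injective, hck]
    · rw [hsupp, himage]
      exact fun h => hcQ h.symm
  · intro c _
    rw [hinv]
    ext x <;> simp [negPerm_negPerm]

theorem count_map_filter_val {ι : Type*} (s : Finset ι) (q : ι → Prop) [DecidablePred q]
    (f : ι → ℕ) (k : ℕ) :
    ((s.filter q).val.map f).count k = #{c ∈ s | f c = k ∧ q c} := by
  rw [Multiset.count_map, ← filter_val, card_val, filter_filter]
  simp only [and_comm, eq_comm]

/-- The cycle type of a signed permutation in terms of the numbers of points on its cycles. -/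
theorem isBnCycleType_iff (hw : Commute w (negPerm n)) {lam mu : Multiset ℕ}
    (hlam : ∀ p ∈ lam, 0 < p) (hmu : ∀ p ∈ mu, 0 < p) :
    IsBnCycleType n w lam mu ↔ ∀ k, 0 < k →
      2 * k * lam.count k = #(posPoints w k) ∧ 2 * k * mu.count k = #(negPoints w k) := by
  have hlam0 : lam.count 0 = 0 := Multiset.count_eq_zero.2 fun h => (hlam 0 h).ne rfl
  have hmu0 : mu.count 0 = 0 := Multiset.count_eq_zero.2 fun h => (hmu 0 h).ne rfl
  have htwo {c : Perm (Fin n × ZMod 2)} (hc : c ∈ w.cycleFactorsFinset) : 2 ≤ #c.support :=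
    (mem_cycleFactorsFinset_iff.1 hc).1.two_le_card_support
  have hneg (k : ℕ) : #{c ∈ w.cycleFactorsFinset | #c.support / 2 = k ∧
      c.support.image (negPerm n) = c.support} = #{c ∈ w.cycleFactorsFinset |
        #c.support = 2 * k ∧ c.support.image (negPerm n) = c.support} := by
    refine congrArg card (filter_congr fun c hc => and_congr_left fun h => ?_)
    obtain ⟨m, hm⟩ := even_card_support hw hc h
    omega
  have hzero (q : Perm (Fin n × ZMod 2) → Prop) [DecidablePred q] (k : ℕ) (hk : k < 2) :
      #{c ∈ w.cycleFactorsFinset | #c.support = k ∧ q c} = 0 := by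
    rw [card_eq_zero, filter_eq_empty_iff]
    rintro c hc ⟨h, -⟩
    have := htwo hc
    omega
  rw [IsBnCycleType, Multiset.ext, Multiset.ext, ← forall_and]
  refine forall_congr' fun k => ?_
  rw [count_map_filter_val, Multiset.count_add, Multiset.count_add, Multiset.count_replicate,
    count_map_filter_val, hneg]
  rcases k.eq_zero_or_pos with rfl | hk
  · rw [mul_zero, hzero _ _ two_pos, hzero _ _ two_pos, hlam0, hmu0]
    simp
  · rw [imp_iff_right hk, card_negPoints hw hk, Nat.mul_right_inj (by omega)]
    refine and_congr_left fun _ => ?_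
    rcases (show 1 < k ∨ 1 = k by omega) with hk2 | rfl
    · rw [card_posPoints hw hk2, if_neg (by omega), mul_comm 2 k, mul_assoc,
        Nat.mul_right_inj (by omega), zero_add, two_mul]
    · rw [card_posPoints_one hw, if_pos rfl, hzero _ _ one_lt_two]
      omega

theorem minimalPeriod_sq (w : Perm (Fin n × ZMod 2)) (x : Fin n × ZMod 2) :
    minimalPeriod (w ^ 2 : Perm _) x = minimalPeriod w x / (minimalPeriod w x).gcd 2 := by
  rw [coe_pow, Function.minimalPeriod_iterate_eq_div_gcd two_ne_zero]

theorem minimalPeriod_sq_of_odd {x : Fin n × ZMod 2} (h : Odd (minimalPeriod w x)) :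
    minimalPeriod (w ^ 2 : Perm _) x = minimalPeriod w x := by
  rw [minimalPeriod_sq, h.coprime_two_right, Nat.div_one]

theorem minimalPeriod_sq_of_even {x : Fin n × ZMod 2} (h : Even (minimalPeriod w x)) :
    2 * minimalPeriod (w ^ 2 : Perm _) x = minimalPeriod w x := by
  rw [minimalPeriod_sq, Nat.gcd_eq_right h.two_dvd, Nat.mul_div_cancel' h.two_dvd]

theorem minimalPeriod_sq_eq_two_mul_iff {x : Fin n × ZMod 2} {i : ℕ} :
    minimalPeriod (w ^ 2 : Perm _) x = 2 * i ↔ minimalPeriod w x = 4 * i := by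
  rcases Nat.even_or_odd (minimalPeriod w x) with h | h
  · have := minimalPeriod_sq_of_even h
    omega
  · have := minimalPeriod_sq_of_odd h
    obtain ⟨m, hm⟩ := h
    omega

theorem minimalPeriod_sq_eq_odd_iff {x : Fin n × ZMod 2} {k : ℕ} (hk : Odd k) :
    minimalPeriod (w ^ 2 : Perm _) x = k ↔ minimalPeriod w x = k ∨ minimalPeriod w x = 2 * k := by
  obtain ⟨l, hl⟩ := hk
  rcases Nat.even_or_odd (minimalPeriod w x) with h | h
  · have := minimalPeriod_sq_of_even h
    obtain ⟨m, hm⟩ := h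
    omega
  · have := minimalPeriod_sq_of_odd h
    obtain ⟨m, hm⟩ := h
    omega

theorem sameCycle_sq_negPerm_iff (hw : Commute w (negPerm n)) {x : Fin n × ZMod 2} {i : ℕ}
    (h : minimalPeriod w x = 4 * i) :
    (w ^ 2).SameCycle x (negPerm n x) ↔ w.SameCycle x (negPerm n x) := by
  refine ⟨fun h => h.of_pow, fun hx => ?_⟩
  obtain ⟨m, hm, h1, -⟩ := exists_pow_of_sameCycle_negPerm hw hx
  rw [h] at h1
  obtain ⟨l, rfl⟩ : 2 ∣ m := by
    obtain ⟨r, hr⟩ := h1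
    rw [mul_assoc] at hr
    omega
  exact ⟨l, by rw [zpow_natCast, ← pow_mul, hm]⟩

theorem posPoints_sq_two_mul (hw : Commute w (negPerm n)) (i : ℕ) :
    posPoints (w ^ 2) (2 * i) = posPoints w (4 * i) := by
  ext x
  rw [mem_posPoints, mem_posPoints, minimalPeriod_sq_eq_two_mul_iff]
  exact and_congr_right fun h => not_congr (sameCycle_sq_negPerm_iff hw h)

theorem negPoints_sq (hw : Commute w (negPerm n)) (j : ℕ) :
    negPoints (w ^ 2) j = negPoints w (2 * j) := by
  ext x
  rw [mem_negPoints, mem_negPoints, minimalPeriod_sq_eq_two_mul_iff, ← mul_assoc]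
  exact and_congr_right fun h => sameCycle_sq_negPerm_iff hw h

theorem card_posPoints_sq_of_odd (hw : Commute w (negPerm n)) {k : ℕ} (hk : Odd k) :
    #(posPoints (w ^ 2) k) = #(posPoints w k) + #(posPoints w (2 * k)) + #(negPoints w k) := by
  have hk0 := hk.pos
  have hnot {f : Perm (Fin n × ZMod 2)} (hf : Commute f (negPerm n)) {x : Fin n × ZMod 2}
      (h : minimalPeriod f x = k) : ¬ f.SameCycle x (negPerm n x) := fun hx =>
    Nat.not_even_iff_odd.2 (h ▸ hk) (even_minimalPeriod_of_sameCycle hf hx)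
  rw [add_assoc, ← card_union_of_disjoint, ← card_union_of_disjoint]
  · congr 1
    ext x
    rw [mem_union, mem_union, mem_posPoints, mem_posPoints, mem_posPoints, mem_negPoints,
      and_iff_left_of_imp (hnot (hw.pow_left 2)), and_iff_left_of_imp (hnot hw),
      minimalPeriod_sq_eq_odd_iff hk]
    tauto
  · refine disjoint_left.2 fun x hx hx' => ?_
    rw [mem_union, mem_posPoints, mem_negPoints] at hx'
    rw [mem_posPoints] at hx
    omega
  · refine disjoint_left.2 fun x hx hx' => ?_
    exact (mem_posPoints.1 hx).2 (mem_negPoints.1 hx').2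

theorem even_counts_of_sq (hw : Commute w (negPerm n)) {lam mu : Multiset ℕ}
    (hlam : ∀ p ∈ lam, 0 < p) (hmu : ∀ p ∈ mu, 0 < p) (h : IsBnCycleType n (w ^ 2) lam mu) :
    (∀ i : ℕ, Even (lam.count (2 * i))) ∧ (∀ j : ℕ, Even (mu.count j)) := by
  rw [isBnCycleType_iff (hw.pow_left 2) hlam hmu] at h
  constructor
  · intro i
    rcases i.eq_zero_or_pos with rfl | hi
    · rw [Multiset.count_eq_zero.2 fun h => (hlam _ h).ne rfl]
      exact Even.zero
    · have h1 := (h (2 * i) (by omega)).1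
      obtain ⟨r, hr⟩ := even_card_positive_cycles hw (4 * i)
      rw [posPoints_sq_two_mul hw, card_posPoints hw (by omega), hr,
        show 2 * (2 * i) = 4 * i by ring, Nat.mul_right_inj (by omega)] at h1
      exact ⟨r, h1⟩
  · intro j
    rcases j.eq_zero_or_pos with rfl | hj
    · rw [Multiset.count_eq_zero.2 fun h => (hmu _ h).ne rfl]
      exact Even.zero
    · have h1 := (h j hj).2
      rw [negPoints_sq hw, card_negPoints hw (by omega), mul_assoc, mul_assoc, mul_assoc 2 j,
        Nat.mul_right_inj two_ne_zero, mul_left_comm, Nat.mul_right_inj hj.ne'] at h1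
      exact ⟨_, h1.trans (two_mul _)⟩

end hyperoctahedral

section model

variable {ι : Type*} {len : ι → ℕ} {n : ℕ}

/-- The signed permutation of `Fin n`, labelled by `e`, that cycles each block `ZMod (len a)` and
changes the sign by `ε a` once along the block. -/
def blockPerm (e : Fin n ≃ Σ a, ZMod (len a)) (ε : ι → ZMod 2) : Perm (Fin n × ZMod 2) :=
  prodShear
    ((e.trans (Equiv.sigmaCongrRight fun a => Equiv.addRight (1 : ZMod (len a)))).trans e.symm)
    fun i => Equiv.addRight (if (e i).2 = 0 then ε (e i).1 else 0)

variable (e : Fin n ≃ Σ a, ZMod (len a)) (ε : ι → ZMod 2)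

theorem blockPerm_apply (a : ι) (x : ZMod (len a)) (s : ZMod 2) :
    blockPerm e ε (e.symm ⟨a, x⟩, s) =
      (e.symm ⟨a, x + 1⟩, s + if x = 0 then ε a else 0) := by
  have h := e.apply_symm_apply ⟨a, x⟩
  change (e.symm ⟨(e (e.symm ⟨a, x⟩)).1, (e (e.symm ⟨a, x⟩)).2 + 1⟩,
    s + if (e (e.symm ⟨a, x⟩)).2 = 0 then ε (e (e.symm ⟨a, x⟩)).1 else 0) = _
  generalize e (e.symm ⟨a, x⟩) = z at h ⊢
  subst h
  rfl

theorem commute_blockPerm : Commute (blockPerm e ε) (negPerm n) := by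
  refine Equiv.ext fun ⟨i, s⟩ => ?_
  obtain ⟨⟨a, x⟩, rfl⟩ := e.symm.surjective i
  simp [blockPerm_apply, negPerm_apply, add_assoc]

theorem blockPerm_pow_apply (m : ℕ) (a : ι) (x : ZMod (len a)) (s : ZMod 2) :
    (blockPerm e ε ^ m) (e.symm ⟨a, x⟩, s) =
      (e.symm ⟨a, x + m⟩, s + ∑ t ∈ range m, if x + t = 0 then ε a else 0) := by
  induction m with
  | zero => simp
  | succ m ih =>
    rw [pow_succ', mul_apply, ih, blockPerm_apply, sum_range_succ, Nat.cast_succ, add_assoc,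
      add_assoc]

theorem blockPerm_pow_len_apply (a : ι) [NeZero (len a)] (x : ZMod (len a)) (s : ZMod 2) :
    (blockPerm e ε ^ len a) (e.symm ⟨a, x⟩, s) = (e.symm ⟨a, x⟩, s + ε a) := by
  rw [blockPerm_pow_apply, ZMod.natCast_self, add_zero, sum_eq_single (-x).val]
  · simp
  · intro t ht hne
    refine if_neg fun h => hne ?_
    rw [← eq_neg_iff_add_eq_zero.2 ((add_comm _ _).trans h),
      ZMod.val_natCast_of_lt (mem_range.1 ht)]
  · exact fun h => absurd (mem_range.2 (ZMod.val_lt _)) h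

theorem len_dvd_of_blockPerm_pow_apply_fst {m : ℕ} {a : ι} {x : ZMod (len a)} {s : ZMod 2}
    (h : ((blockPerm e ε ^ m) (e.symm ⟨a, x⟩, s)).1 = e.symm ⟨a, x⟩) : len a ∣ m := by
  rw [blockPerm_pow_apply] at h
  have h' := e.symm.injective h
  rw [Sigma.mk.injEq, heq_eq_eq, add_eq_left] at h'
  exact (ZMod.natCast_eq_zero_iff _ _).1 h'.2

theorem len_dvd_minimalPeriod (a : ι) (x : ZMod (len a)) (s : ZMod 2) :
    len a ∣ minimalPeriod (blockPerm e ε) (e.symm ⟨a, x⟩, s) :=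
  len_dvd_of_blockPerm_pow_apply_fst e ε (s := s)
    (congrArg Prod.fst ((pow_apply_eq_self_iff_minimalPeriod_dvd _ _ _).2 dvd_rfl))

theorem blockPerm_positive {a : ι} [NeZero (len a)] (ha : ε a = 0) (x : ZMod (len a))
    (s : ZMod 2) :
    minimalPeriod (blockPerm e ε) (e.symm ⟨a, x⟩, s) = len a ∧
      ¬ (blockPerm e ε).SameCycle (e.symm ⟨a, x⟩, s) (negPerm n (e.symm ⟨a, x⟩, s)) := by
  have hfix := blockPerm_pow_len_apply e ε a x s
  rw [ha, add_zero, pow_apply_eq_self_iff_minimalPeriod_dvd] at hfix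
  have hlen := Nat.dvd_antisymm hfix (len_dvd_minimalPeriod e ε a x s)
  refine ⟨hlen, fun h => ?_⟩
  obtain ⟨m, hm, -, hndvd⟩ := exists_pow_of_sameCycle_negPerm (commute_blockPerm e ε) h
  refine hndvd (hlen ▸ len_dvd_of_blockPerm_pow_apply_fst e ε (x := x) (s := s) ?_)
  rw [hm, negPerm_apply]

theorem blockPerm_negative {a : ι} [NeZero (len a)] (ha : ε a = 1) (x : ZMod (len a))
    (s : ZMod 2) :
    minimalPeriod (blockPerm e ε) (e.symm ⟨a, x⟩, s) = 2 * len a ∧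
      (blockPerm e ε).SameCycle (e.symm ⟨a, x⟩, s) (negPerm n (e.symm ⟨a, x⟩, s)) := by
  have hpow : (blockPerm e ε ^ len a) (e.symm ⟨a, x⟩, s) = negPerm n (e.symm ⟨a, x⟩, s) := by
    rw [blockPerm_pow_len_apply, ha, negPerm_apply, add_comm]
  have hsame : (blockPerm e ε).SameCycle (e.symm ⟨a, x⟩, s) (negPerm n (e.symm ⟨a, x⟩, s)) :=
    ⟨len a, by rw [zpow_natCast, hpow]⟩
  refine ⟨?_, hsame⟩
  have hlen := NeZero.pos (len a)
  obtain ⟨c, hc⟩ := len_dvd_minimalPeriod e ε a x s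
  have hc2 : minimalPeriod (blockPerm e ε) (e.symm ⟨a, x⟩, s) ∣ len a * 2 := by
    rw [← pow_apply_eq_self_iff_minimalPeriod_dvd, mul_two, pow_add, mul_apply, hpow,
      pow_negPerm (commute_blockPerm e ε), hpow, negPerm_negPerm]
  rw [hc, Nat.mul_dvd_mul_iff_left hlen, Nat.dvd_prime Nat.prime_two] at hc2
  rcases hc2 with rfl | rfl
  · refine absurd ((pow_apply_eq_self_iff_minimalPeriod_dvd _ _ (len a)).2 ?_)
      (hpow ▸ negPerm_ne (e.symm ⟨a, x⟩, s))
    rw [hc, mul_one]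
  · rw [hc, mul_comm]

variable [∀ a, NeZero (len a)]

theorem card_block_points [Fintype ι] [DecidableEq ι] (p : ι → Prop) [DecidablePred p] (k : ℕ)
    (hp : ∀ a, p a → len a = k) :
    #{y : Fin n × ZMod 2 | p (e y.1).1} = 2 * k * #{a | p a} := by
  rw [card_eq_sum_card_fiberwise (f := fun y : Fin n × ZMod 2 => (e y.1).1) (t := {a | p a})
    (fun y hy => by simpa using hy)]
  rw [sum_const_nat (m := 2 * k), mul_comm]
  intro a ha
  have hpa : p a := (mem_filter.1 ha).2
  have : ({y ∈ ({y : Fin n × ZMod 2 | p (e y.1).1} : Finset _) | (e y.1).1 = a} : Finset _) =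
      (univ : Finset (ZMod (len a) × ZMod 2)).image fun z => (e.symm ⟨a, z.1⟩, z.2) := by
    ext ⟨i, s⟩
    obtain ⟨⟨b, x⟩, rfl⟩ := e.symm.surjective i
    simp only [mem_filter, mem_univ, true_and, apply_symm_apply, mem_image, Prod.mk.injEq,
      Prod.exists, e.symm.injective.eq_iff]
    constructor
    · rintro ⟨-, rfl⟩
      exact ⟨x, s, rfl, rfl⟩
    · rintro ⟨z, t, h, -⟩
      obtain rfl : a = b := congrArg Sigma.fst h
      exact ⟨hpa, rfl⟩
  rw [this, card_image_of_injective, card_univ, Fintype.card_prod, ZMod.card, ZMod.card, hp a hpa,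
    mul_comm]
  intro z z' h
  obtain ⟨h1, h2⟩ := Prod.mk.inj h
  have := e.symm.injective h1
  rw [Sigma.mk.injEq, heq_eq_eq] at this
  exact Prod.ext this.2 h2

theorem posPoints_blockPerm (k : ℕ) : posPoints (blockPerm e ε) k =
    ({y | len (e y.1).1 = k ∧ ε (e y.1).1 = 0} : Finset (Fin n × ZMod 2)) := by
  ext ⟨i, s⟩
  obtain ⟨⟨a, x⟩, rfl⟩ := e.symm.surjective i
  rw [mem_posPoints, mem_filter, apply_symm_apply]
  rcases (show ∀ t : ZMod 2, t = 0 ∨ t = 1 by decide) (ε a) with h | h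
  · simp [blockPerm_positive e ε h x s, h]
  · simp [blockPerm_negative e ε h x s, h]

theorem negPoints_blockPerm (k : ℕ) : negPoints (blockPerm e ε) k =
    ({y | len (e y.1).1 = k ∧ ε (e y.1).1 = 1} : Finset (Fin n × ZMod 2)) := by
  ext ⟨i, s⟩
  obtain ⟨⟨a, x⟩, rfl⟩ := e.symm.surjective i
  rw [mem_negPoints, mem_filter, apply_symm_apply]
  rcases (show ∀ t : ZMod 2, t = 0 ∨ t = 1 by decide) (ε a) with h | h
  · simp [blockPerm_positive e ε h x s, h]
  · simp [blockPerm_negative e ε h x s, h]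

end model

theorem card_coe_eq_count (α : Multiset ℕ) (k : ℕ) :
    #{a : α | a.1 = k} = α.count k := by
  conv_rhs => rw [← Multiset.map_univ_coe α, Multiset.count_map, ← filter_val, card_val]
  simp only [eq_comm]

/-- Every bipartition of `n` is the cycle type of an element of `B_n`. -/
theorem exists_isBnCycleType {n : ℕ} {α β : Multiset ℕ} (hα : ∀ p ∈ α, 0 < p)
    (hβ : ∀ p ∈ β, 0 < p) (hsum : α.sum + β.sum = n) :
    ∃ w : Perm (Fin n × ZMod 2), Commute w (negPerm n) ∧ IsBnCycleType n w α β := by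
  classical
  let len : α ⊕ β → ℕ := Sum.elim (fun a => a.1) (fun b => b.1)
  let ε : α ⊕ β → ZMod 2 := Sum.elim (fun _ => 0) (fun _ => 1)
  have : ∀ a, NeZero (len a) := by
    rintro (a | b)
    · exact ⟨(hα _ (Multiset.coe_mem (x := a))).ne'⟩
    · exact ⟨(hβ _ (Multiset.coe_mem (x := b))).ne'⟩
  have hcard : Fintype.card (Fin n) = Fintype.card (Σ a, ZMod (len a)) := by
    rw [Fintype.card_fin, Fintype.card_sigma, Fintype.sum_congr _ _ fun a => ZMod.card (len a),
      Fintype.sum_sum_type, ← hsum]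
    conv_lhs => rw [← Multiset.map_univ_coe α, ← Multiset.map_univ_coe β]
    rfl
  let e := Fintype.equivOfCardEq hcard
  refine ⟨blockPerm e ε, commute_blockPerm e ε,
    (isBnCycleType_iff (commute_blockPerm e ε) hα hβ).2 fun k _ => ?_⟩
  rw [posPoints_blockPerm, negPoints_blockPerm,
    card_block_points e (fun a => len a = k ∧ ε a = 0) k fun _ h => h.1,
    card_block_points e (fun a => len a = k ∧ ε a = 1) k fun _ h => h.1,
    ← card_coe_eq_count α, ← card_coe_eq_count β]
  simp only [card_filter, Fintype.sum_sum_type]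
  simp [len, ε]

theorem exists_sq_of_even_counts {n : ℕ} {lam mu : Multiset ℕ} (hlam : ∀ p ∈ lam, 0 < p)
    (hmu : ∀ p ∈ mu, 0 < p) (hsum : lam.sum + mu.sum = n)
    (hlam2 : ∀ i : ℕ, Even (lam.count (2 * i))) (hmu2 : ∀ j : ℕ, Even (mu.count j)) :
    ∃ w : Perm (Fin n × ZMod 2), Commute w (negPerm n) ∧ IsBnCycleType n (w ^ 2) lam mu := by
  obtain ⟨M, rfl⟩ := Multiset.exists_smul_of_dvd_count mu fun a _ => (hmu2 a).two_dvd
  obtain ⟨H, hH⟩ := Multiset.exists_smul_of_dvd_count (k := 2) (lam.filter Even) fun a ha => by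
    obtain ⟨b, rfl⟩ := (Multiset.of_mem_filter ha).two_dvd
    rw [Multiset.count_filter_of_pos (even_two_mul b)]
    exact (hlam2 b).two_dvd
  have hsplit : lam = 2 • H + lam.filter fun a => ¬ Even a := by
    rw [← hH, Multiset.filter_add_not]
  have hHlam {p : ℕ} (hp : p ∈ H) : 0 < p ∧ Even p := by
    have : p ∈ lam.filter Even := by rw [hH, two_nsmul]; exact Multiset.mem_add.2 (.inl hp)
    exact ⟨hlam p (Multiset.mem_of_mem_filter this), Multiset.of_mem_filter this⟩
  have hM {p : ℕ} (hp : p ∈ M) : 0 < p :=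
    hmu p (by rw [two_nsmul]; exact Multiset.mem_add.2 (.inl hp))
  have hinj : Function.Injective (2 * · : ℕ → ℕ) := mul_right_injective₀ two_ne_zero
  have hodd_map (K : Multiset ℕ) {k : ℕ} (hk : Odd k) : (K.map (2 * ·)).count k = 0 := by
    rw [Multiset.count_eq_zero, Multiset.mem_map]
    rintro ⟨a, -, rfl⟩
    exact Nat.not_even_iff_odd.2 hk (even_two_mul a)
  set α := H.map (2 * ·) + lam.filter fun a => ¬ Even a with hα
  set β := M.map (2 * ·) with hβ
  have hαpos : ∀ p ∈ α, 0 < p := by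
    intro p hp
    rcases Multiset.mem_add.1 hp with hp | hp
    · obtain ⟨a, ha, rfl⟩ := Multiset.mem_map.1 hp
      exact Nat.mul_pos two_pos (hHlam ha).1
    · exact hlam p (Multiset.mem_of_mem_filter hp)
  have hβpos : ∀ p ∈ β, 0 < p := by
    intro p hp
    obtain ⟨a, ha, rfl⟩ := Multiset.mem_map.1 hp
    exact Nat.mul_pos two_pos (hM ha)
  have hsum' : α.sum + β.sum = n := by
    rw [← hsum, hα, hβ, Multiset.sum_add, Multiset.sum_map_mul_left, Multiset.sum_map_mul_left,
      Multiset.map_id', Multiset.map_id', Multiset.sum_nsmul]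
    nth_rewrite 2 [hsplit]
    rw [Multiset.sum_add, Multiset.sum_nsmul]
    rfl
  obtain ⟨w, hw, hcyc⟩ := exists_isBnCycleType hαpos hβpos hsum'
  rw [isBnCycleType_iff hw hαpos hβpos] at hcyc
  refine ⟨w, hw, (isBnCycleType_iff (hw.pow_left 2) hlam hmu).2 fun k hk => ⟨?_, ?_⟩⟩
  · rcases Nat.even_or_odd k with hke | hko
    · obtain ⟨i, rfl⟩ := hke.two_dvd
      rw [posPoints_sq_two_mul hw, ← (hcyc (4 * i) (by omega)).1, hα, Multiset.count_add,
        show 4 * i = 2 * (2 * i) by ring, Multiset.count_map_eq_count' _ _ hinj,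
        Multiset.count_filter_of_neg (p := fun a => ¬ Even a) (not_not.2 (even_two_mul _)), hsplit,
        Multiset.count_add, Multiset.count_nsmul,
        Multiset.count_filter_of_neg (p := fun a => ¬ Even a) (not_not.2 (even_two_mul _))]
      ring
    · rw [card_posPoints_sq_of_odd hw hko, ← (hcyc k hk).1, ← (hcyc k hk).2,
        ← (hcyc (2 * k) (by omega)).1, hβ, hodd_map M hko, hα, Multiset.count_add,
        Multiset.count_add, hodd_map H hko, Multiset.count_map_eq_count' _ _ hinj,
        Multiset.count_filter_of_pos (p := fun a => ¬ Even a) (Nat.not_even_iff_odd.2 hko),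
        Multiset.count_filter_of_neg (p := fun a => ¬ Even a) (not_not.2 (even_two_mul _)),
        Multiset.count_eq_zero.2 fun h => Nat.not_even_iff_odd.2 hko (hHlam h).2]
      ring
  · rw [negPoints_sq hw, ← (hcyc (2 * k) (by omega)).2, hβ,
      Multiset.count_map_eq_count' _ _ hinj, Multiset.count_nsmul]
    ring

end BnSquare

/-- A bipartition `(lam | mu)` of `n` is the cycle type of the square of an
element of `B_n` iff every even part of `lam` has even multiplicity and every
part of `mu` has even multiplicity. -/
theorem bipartition_is_square_cycleType_iff (n : ℕ) (lam mu : Multiset ℕ)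
    (hlam : ∀ p ∈ lam, 0 < p) (hmu : ∀ p ∈ mu, 0 < p)
    (hsum : lam.sum + mu.sum = n) :
    (∃ π : Equiv.Perm (Fin n × ZMod 2), π ∈ hyperoctahedral n ∧
        IsBnCycleType n (π ^ 2) lam mu) ↔
      (∀ i : ℕ, Even (lam.count (2 * i))) ∧ (∀ j : ℕ, Even (mu.count j)) := by
  constructor
  · rintro ⟨w, hw, h⟩
    exact BnSquare.even_counts_of_sq (BnSquare.mem_hyperoctahedral_iff.1 hw) hlam hmu h
  · rintro ⟨h1, h2⟩
    obtain ⟨w, hw, h⟩ := BnSquare.exists_sq_of_even_counts hlam hmu hsum h1 h2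
    exact ⟨w, BnSquare.mem_hyperoctahedral_iff.2 hw, h⟩
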